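/- arXiv:2103.07831 — 2 statements merged into one kernel-verified Lean document; each statement's English description precedes it below -/
import Mathlib

section
/- Under these hypotheses, for every multi-index n = (n₁,…,n_d) ∈ ℕ^d with Σn ≥ 1, the mixed partial derivative of the implicit zero satisfies ∂(φ,n) = −(α^{1+Σ_{i=1}^d n_i(γ_i−1)}/(bβα^{β−1})^{Σn})·∏_{i=1}^{Σn−1}(−1 + iβ − Σ_{j=1}^d n_jγ_j). -/
open Finset Complex


/-- The partial derivative ∂/∂aᵢ of a function ℂ^d → ℂ. -/
noncomputable def pderivC {d : ℕ} (i : Fin d) (ψ : (Fin d → ℂ) → ℂ) :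
    (Fin d → ℂ) → ℂ :=
  fun a => deriv (fun t => ψ (Function.update a i t)) (a i)

/-- The mixed partial derivative (∂/∂a₁)^{n₁} ⋯ (∂/∂a_d)^{n_d} ψ. -/
noncomputable def mixedPartial {d : ℕ} (n : Fin d → ℕ) (ψ : (Fin d → ℂ) → ℂ) :
    (Fin d → ℂ) → ℂ :=
  ((List.ofFn fun i : Fin d => (pderivC i)^[n i]).foldr (· ∘ ·) id) ψ

/-- The iterated partial derivative along a list of directions, the last entry acting first. -/
noncomputable def iteratedPderivC {d : ℕ} (L : List (Fin d)) (ψ : (Fin d → ℂ) → ℂ) :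
    (Fin d → ℂ) → ℂ :=
  L.foldr pderivC ψ

section Calculus

variable {d : ℕ} {U : Set (Fin d → ℂ)} {f g : (Fin d → ℂ) → ℂ} {a : Fin d → ℂ}

theorem iteratedPderivC_cons (i : Fin d) (L : List (Fin d)) (ψ : (Fin d → ℂ) → ℂ) :
    iteratedPderivC (i :: L) ψ = pderivC i (iteratedPderivC L ψ) := rfl

theorem iteratedPderivC_concat (L : List (Fin d)) (i : Fin d) (ψ : (Fin d → ℂ) → ℂ) :
    iteratedPderivC (L ++ [i]) ψ = iteratedPderivC L (pderivC i ψ) := by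
  simp [iteratedPderivC]

theorem DifferentiableAt.hasDerivAt_comp_update (hf : DifferentiableAt ℂ f a) (i : Fin d) :
    HasDerivAt (fun t => f (Function.update a i t)) (fderiv ℂ f a (Pi.single i 1)) (a i) := by
  have h : HasFDerivAt f (fderiv ℂ f a) (Function.update a i (a i)) := by
    simpa using hf.hasFDerivAt
  exact h.comp_hasDerivAt (a i) (hasDerivAt_update a i (a i))

theorem pderivC_eq_fderiv (hf : DifferentiableAt ℂ f a) (i : Fin d) :
    pderivC i f a = fderiv ℂ f a (Pi.single i 1) :=
  (hf.hasDerivAt_comp_update i).deriv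

theorem eventually_update_mem (hU : IsOpen U) (ha : a ∈ U) (i : Fin d) :
    ∀ᶠ t in nhds (a i), Function.update a i t ∈ U := by
  have h : ContinuousAt (fun t => Function.update a i t) (a i) :=
    (hasDerivAt_update a i (a i)).continuousAt
  exact h (by simpa using hU.mem_nhds ha)

theorem pderivC_congr (hU : IsOpen U) (h : Set.EqOn f g U) (i : Fin d) :
    Set.EqOn (pderivC i f) (pderivC i g) U := fun _ ha =>
  Filter.EventuallyEq.deriv_eq ((eventually_update_mem hU ha i).mono fun _ ht => h ht)

theorem iteratedPderivC_congr (hU : IsOpen U) (h : Set.EqOn f g U) (L : List (Fin d)) :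
    Set.EqOn (iteratedPderivC L f) (iteratedPderivC L g) U := by
  induction L with
  | nil => exact h
  | cons i L ih => exact pderivC_congr hU ih i

theorem ContDiffOn.differentiableAt_of_mem_open (hU : IsOpen U)
    (hf : ContDiffOn ℂ (⊤ : ℕ∞) f U) (ha : a ∈ U) : DifferentiableAt ℂ f a :=
  (hf.differentiableOn (by simp)).differentiableAt (hU.mem_nhds ha)

theorem ContDiffOn.pderivC (hU : IsOpen U) (hf : ContDiffOn ℂ (⊤ : ℕ∞) f U) (i : Fin d) :
    ContDiffOn ℂ (⊤ : ℕ∞) (pderivC i f) U := by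
  have h : ContDiffOn ℂ (⊤ : ℕ∞) (fun a => fderiv ℂ f a (Pi.single i 1)) U :=
    (hf.fderiv_of_isOpen hU (by simp)).clm_apply contDiffOn_const
  exact h.congr fun a ha => pderivC_eq_fderiv (hf.differentiableAt_of_mem_open hU ha) i

theorem ContDiffOn.iteratedPderivC (hU : IsOpen U) (hf : ContDiffOn ℂ (⊤ : ℕ∞) f U)
    (L : List (Fin d)) : ContDiffOn ℂ (⊤ : ℕ∞) (iteratedPderivC L f) U := by
  induction L with
  | nil => exact hf
  | cons i L ih => exact ih.pderivC hU i

theorem pderivC_add (hf : DifferentiableAt ℂ f a) (hg : DifferentiableAt ℂ g a) (i : Fin d) :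
    pderivC i (fun x => f x + g x) a = pderivC i f a + pderivC i g a := by
  rw [pderivC_eq_fderiv hf, pderivC_eq_fderiv hg]
  exact ((hf.hasDerivAt_comp_update i).add (hg.hasDerivAt_comp_update i)).deriv

theorem pderivC_const_mul (hf : DifferentiableAt ℂ f a) (c : ℂ) (i : Fin d) :
    pderivC i (fun x => c * f x) a = c * pderivC i f a := by
  rw [pderivC_eq_fderiv hf]
  exact ((hf.hasDerivAt_comp_update i).const_mul c).deriv

theorem pderivC_coord_mul (hf : DifferentiableAt ℂ f a) (i j : Fin d) :
    pderivC i (fun x => x j * f x) a = (if i = j then 1 else 0) * f a + a j * pderivC i f a := by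
  rw [pderivC_eq_fderiv hf]
  have h := (hasDerivAt_pi.1 (hasDerivAt_update a i (a i)) j).mul (hf.hasDerivAt_comp_update i)
  refine h.deriv.trans ?_
  simp [Pi.single_apply, eq_comm]

theorem iteratedPderivC_add (hU : IsOpen U) (hf : ContDiffOn ℂ (⊤ : ℕ∞) f U)
    (hg : ContDiffOn ℂ (⊤ : ℕ∞) g U) (L : List (Fin d)) :
    Set.EqOn (iteratedPderivC L fun x => f x + g x)
      (fun x => iteratedPderivC L f x + iteratedPderivC L g x) U := by
  induction L with
  | nil => exact fun _ _ => rfl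
  | cons i L ih =>
    intro a ha
    exact (pderivC_congr hU ih i ha).trans (pderivC_add
      ((hf.iteratedPderivC hU L).differentiableAt_of_mem_open hU ha)
      ((hg.iteratedPderivC hU L).differentiableAt_of_mem_open hU ha) i)

theorem iteratedPderivC_const_mul (hU : IsOpen U) (hf : ContDiffOn ℂ (⊤ : ℕ∞) f U) (c : ℂ)
    (L : List (Fin d)) :
    Set.EqOn (iteratedPderivC L fun x => c * f x) (fun x => c * iteratedPderivC L f x) U := by
  induction L with
  | nil => exact fun _ _ => rfl
  | cons i L ih =>
    intro a ha
    exact (pderivC_congr hU ih i ha).trans (pderivC_const_mul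
      ((hf.iteratedPderivC hU L).differentiableAt_of_mem_open hU ha) c i)

theorem iteratedPderivC_zero (L : List (Fin d)) :
    iteratedPderivC L (fun _ => (0 : ℂ)) = fun _ => 0 := by
  induction L with
  | nil => rfl
  | cons i L ih => rw [iteratedPderivC_cons, ih]; funext a; simp [_root_.pderivC]

theorem iteratedPderivC_sum (hU : IsOpen U) {ι : Type*} (s : Finset ι)
    {F : ι → (Fin d → ℂ) → ℂ} (hF : ∀ k, ContDiffOn ℂ (⊤ : ℕ∞) (F k) U) (L : List (Fin d)) :
    Set.EqOn (iteratedPderivC L fun x => ∑ k ∈ s, F k x)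
      (fun x => ∑ k ∈ s, iteratedPderivC L (F k) x) U := by
  classical
  induction s using Finset.induction_on with
  | empty => intro a _; simp [iteratedPderivC_zero]
  | insert k s hk ih =>
    intro a ha
    simp only [Finset.sum_insert hk]
    exact (iteratedPderivC_add hU (hF k) (ContDiffOn.sum fun k _ => hF k) L ha).trans
      (congrArg _ (ih ha))

/-- Leibniz rule at the origin for a coordinate times `f`, when all derivatives of `f` that
occur take the same value. -/
theorem iteratedPderivC_coord_mul_zero (hU : IsOpen U) (h0 : (0 : Fin d → ℂ) ∈ U) (j : Fin d)
    (A : ℂ) (L : List (Fin d)) (hf : ContDiffOn ℂ (⊤ : ℕ∞) f U)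
    (hA : ∀ M : List (Fin d), (j :: M).Perm L → iteratedPderivC M f 0 = A) :
    iteratedPderivC L (fun x => x j * f x) 0 = L.count j * A := by
  induction L using List.reverseRecOn generalizing f with
  | nil => simp [iteratedPderivC]
  | append_singleton L k ih =>
    have hcoord : ContDiffOn ℂ (⊤ : ℕ∞) (fun x : Fin d → ℂ => x j) U :=
      (contDiff_apply ℂ ℂ j).contDiffOn
    have hstep : Set.EqOn (pderivC k fun x => x j * f x)
        (fun x => (if k = j then 1 else 0) * f x + x j * pderivC k f x) U := fun a ha =>
      pderivC_coord_mul (hf.differentiableAt_of_mem_open hU ha) k j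
    have hrest : iteratedPderivC L (fun x => x j * pderivC k f x) 0 = L.count j * A := by
      refine ih (hf.pderivC hU k) fun M hM => ?_
      rw [← iteratedPderivC_concat]
      exact hA _ (hM.append_right [k])
    rw [iteratedPderivC_concat, iteratedPderivC_congr hU hstep L h0,
      iteratedPderivC_add hU (contDiffOn_const.mul hf) (hcoord.mul (hf.pderivC hU k)) L h0]
    beta_reduce
    rw [iteratedPderivC_const_mul hU hf _ L h0, hrest]
    by_cases hkj : k = j
    · subst hkj
      beta_reduce
      rw [hA L (by simpa using List.perm_append_comm (l₁ := [k]) (l₂ := L))]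
      simp
      ring
    · simp [hkj]

end Calculus

theorem mixedPartial_eq_iteratedPderivC {d : ℕ} (n : Fin d → ℕ) (ψ : (Fin d → ℂ) → ℂ) :
    mixedPartial n ψ =
      iteratedPderivC ((List.finRange d).flatMap fun i => List.replicate (n i) i) ψ := by
  have hrep : ∀ (i : Fin d) (m : ℕ) (χ : (Fin d → ℂ) → ℂ),
      (pderivC i)^[m] χ = (List.replicate m i).foldr pderivC χ := by
    intro i m χ
    induction m with
    | zero => rfl
    | succ m ih => rw [Function.iterate_succ_apply', ih]; rfl
  rw [mixedPartial, iteratedPderivC, List.ofFn_eq_map]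
  induction List.finRange d with
  | nil => rfl
  | cons i l ih => simp [ih, hrep]

theorem sum_map_flatMap_replicate {d : ℕ} (n : Fin d → ℕ) (c : Fin d → ℂ) :
    ((((List.finRange d).flatMap fun i => List.replicate (n i) i).map c).sum : ℂ) =
      ∑ i, (n i : ℂ) * c i := by
  rw [← List.sum_ofFn, List.ofFn_eq_map]
  induction List.finRange d with
  | nil => rfl
  | cons i l ih => simp_all

theorem sum_count_mul {d : ℕ} (c : Fin d → ℂ) (L : List (Fin d)) :
    ∑ j, (L.count j : ℂ) * c j = (L.map c).sum := by
  induction L with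
  | nil => simp
  | cons i L ih =>
    simp [List.count_cons, add_mul, Finset.sum_add_distrib, ih, add_comm]

/-- Solution of the recursion expressing each partial derivative of `V q` as an Euler operator
applied to `V (q + γ i)`. -/
theorem iteratedPderivC_zero_of_euler_recursion {d : ℕ} {U : Set (Fin d → ℂ)} (hU : IsOpen U)
    (h0 : (0 : Fin d → ℂ) ∈ U) (γ : Fin d → ℂ) (β : ℂ) (V : ℂ → (Fin d → ℂ) → ℂ)
    (hV : ∀ q, ContDiffOn ℂ (⊤ : ℕ∞) (V q) U)
    (hrec : ∀ i q, Set.EqOn (pderivC i (V q)) (fun a => ((q + γ i) / β - 1) * V (q + γ i) a +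
      ∑ j, (γ j / β - 1) * (a j * pderivC j (V (q + γ i)) a)) U)
    (L : List (Fin d)) (q : ℂ) :
    iteratedPderivC L (V q) 0 = V (q + (L.map γ).sum) 0 *
      ∏ k ∈ Finset.Icc 1 L.length, ((q + (L.map γ).sum) / β - (k : ℂ)) := by
  induction hm : L.length generalizing L q with
  | zero =>
    obtain rfl := List.length_eq_zero_iff.1 hm
    simp [iteratedPderivC]
  | succ m ih =>
    obtain rfl | ⟨L, i, rfl⟩ := L.eq_nil_or_concat'
    · simp at hm
    have hlen : L.length = m := by simpa using hm
    have hcoord : ∀ j, ContDiffOn ℂ (⊤ : ℕ∞)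
        (fun x : Fin d → ℂ => x j * pderivC j (V (q + γ i)) x) U := fun j =>
      (contDiff_apply ℂ ℂ j).contDiffOn.mul ((hV _).pderivC hU j)
    have hleib : ∀ j, iteratedPderivC L (fun x => x j * pderivC j (V (q + γ i)) x) 0 =
        L.count j * (V (q + γ i + (L.map γ).sum) 0 *
          ∏ k ∈ Finset.Icc 1 m, ((q + γ i + (L.map γ).sum) / β - (k : ℂ))) := by
      refine fun j => iteratedPderivC_coord_mul_zero hU h0 j _ L ((hV _).pderivC hU j) fun M hM => ?_
      have hML : (M ++ [j]).Perm L := (List.perm_append_comm (l₁ := M) (l₂ := [j])).trans hM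
      rw [← iteratedPderivC_concat, ih _ _ (hML.length_eq.trans hlen), (hML.map γ).sum_eq]
    have hS : q + ((L ++ [i]).map γ).sum = q + γ i + (L.map γ).sum := by
      simp; ring
    have hcount : ∑ j, (γ j / β - 1) * (L.count j : ℂ) = (L.map γ).sum / β - m := by
      have h1 := sum_count_mul γ L
      have h2 := sum_count_mul (fun _ => (1 : ℂ)) L
      simp only [List.map_const', List.sum_replicate, hlen, nsmul_eq_mul, mul_one] at h2
      rw [← h1, ← h2, Finset.sum_div, ← Finset.sum_sub_distrib]
      exact Finset.sum_congr rfl fun j _ => by ring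
    rw [iteratedPderivC_concat, iteratedPderivC_congr hU (hrec i q) L h0,
      iteratedPderivC_add hU (contDiffOn_const.mul (hV _))
        (ContDiffOn.sum fun j _ => contDiffOn_const.mul (hcoord j)) L h0]
    beta_reduce
    rw [iteratedPderivC_const_mul hU (hV _) _ L h0,
      iteratedPderivC_sum hU _ (fun j => contDiffOn_const.mul (hcoord j)) L h0]
    beta_reduce
    have hterm : ∀ j, iteratedPderivC L
        (fun x => (γ j / β - 1) * (x j * pderivC j (V (q + γ i)) x)) 0 =
        (γ j / β - 1) * L.count j * (V (q + γ i + (L.map γ).sum) 0 *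
          ∏ k ∈ Finset.Icc 1 m, ((q + γ i + (L.map γ).sum) / β - (k : ℂ))) := fun j => by
      rw [iteratedPderivC_const_mul hU (hcoord j) _ L h0]
      beta_reduce
      rw [hleib, mul_assoc]
    rw [Finset.sum_congr rfl fun j _ => hterm j, ih L _ hlen, hS,
      Finset.prod_Icc_succ_top (by omega), ← Finset.sum_mul, hcount]
    push_cast
    ring

/-- The generalized polynomial `B z^e + ∑ aⱼ cⱼ z^(εⱼ)`. -/
noncomputable def expSum {d : ℕ} (B e : ℂ) (c ε : Fin d → ℂ) (a : Fin d → ℂ) (z : ℂ) : ℂ :=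
  B * z ^ e + ∑ j, a j * (c j * z ^ ε j)

section ImplicitZero

variable {d : ℕ} {U : Set (Fin d → ℂ)} {φ : (Fin d → ℂ) → ℂ} {a : Fin d → ℂ}

theorem hasDerivAt_expSum_update (hφ : DifferentiableAt ℂ φ a) (ha : φ a ∈ Complex.slitPlane)
    (B e : ℂ) (c ε : Fin d → ℂ) (i : Fin d) :
    HasDerivAt (fun t => expSum B e c ε (Function.update a i t) (φ (Function.update a i t)))
      (c i * φ a ^ ε i +
        expSum (B * e) (e - 1) (fun j => c j * ε j) (fun j => ε j - 1) a (φ a) * pderivC i φ a)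
      (a i) := by
  have hp : HasDerivAt (fun t => φ (Function.update a i t)) (pderivC i φ a) (a i) :=
    pderivC_eq_fderiv hφ i ▸ hφ.hasDerivAt_comp_update i
  have hpow : ∀ w : ℂ, HasDerivAt (fun t => φ (Function.update a i t) ^ w)
      (w * φ a ^ (w - 1) * pderivC i φ a) (a i) := fun w => by
    simpa using hp.cpow_const (c := w) (by simpa using ha)
  have hsum := HasDerivAt.fun_sum (u := Finset.univ) fun j _ =>
    (hasDerivAt_pi.1 (hasDerivAt_update a i (a i)) j).mul ((hpow (ε j)).const_mul (c j))
  refine (((hpow e).const_mul B).add hsum).congr_deriv ?_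
  simp only [Function.update_eq_self, Finset.sum_add_distrib, Pi.single_apply, ite_mul, one_mul,
    zero_mul, Finset.sum_ite_eq', Finset.mem_univ, if_true, expSum, add_mul, Finset.sum_mul]
  have : ∀ j, a j * (c j * (ε j * φ a ^ (ε j - 1) * pderivC i φ a)) =
      a j * (c j * ε j * φ a ^ (ε j - 1)) * pderivC i φ a := fun j => by ring
  simp only [this]
  ring

theorem ContDiffOn.cpow_const (hφ : ContDiffOn ℂ (⊤ : ℕ∞) φ U)
    (hslit : ∀ a ∈ U, φ a ∈ Complex.slitPlane) (w : ℂ) :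
    ContDiffOn ℂ (⊤ : ℕ∞) (fun a => φ a ^ w) U := by
  have hlog : ContDiffOn ℂ (⊤ : ℕ∞) (fun a => Complex.log (φ a)) U := fun a ha =>
    (Complex.contDiffAt_log (hslit a ha)).comp_contDiffWithinAt a (hφ a ha)
  exact (hlog.mul contDiffOn_const).cexp.congr fun a ha =>
    Complex.cpow_def_of_ne_zero (Complex.slitPlane_ne_zero (hslit a ha)) w

theorem ContDiffOn.expSum (hφ : ContDiffOn ℂ (⊤ : ℕ∞) φ U)
    (hslit : ∀ a ∈ U, φ a ∈ Complex.slitPlane) (B e : ℂ) (c ε : Fin d → ℂ) :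
    ContDiffOn ℂ (⊤ : ℕ∞) (fun a => expSum B e c ε a (φ a)) U :=
  (contDiffOn_const.mul (hφ.cpow_const hslit e)).add (ContDiffOn.sum fun j _ =>
    (contDiff_apply ℂ ℂ j).contDiffOn.mul (contDiffOn_const.mul (hφ.cpow_const hslit (ε j))))

/-- The `z`-derivative at `z = φ a` of `1 + b z^β + ∑ aⱼ z^(γⱼ)`. -/
noncomputable def zeroSlope {d : ℕ} (b β : ℂ) (γ : Fin d → ℂ) (φ : (Fin d → ℂ) → ℂ)
    (a : Fin d → ℂ) : ℂ :=
  expSum (b * β) (β - 1) (fun j => 1 * γ j) (fun j => γ j - 1) a (φ a)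

variable {b β : ℂ} {γ : Fin d → ℂ}

theorem zeroSlope_mul_pderivC (hU : IsOpen U) (hφ : ContDiffOn ℂ (⊤ : ℕ∞) φ U)
    (hslit : ∀ a ∈ U, φ a ∈ Complex.slitPlane)
    (hzero : ∀ a ∈ U, 1 + b * φ a ^ β + ∑ i, a i * φ a ^ γ i = 0) (ha : a ∈ U) (i : Fin d) :
    zeroSlope b β γ φ a * pderivC i φ a = -φ a ^ γ i := by
  have h := hasDerivAt_expSum_update (hφ.differentiableAt_of_mem_open hU ha) (hslit a ha) b β
    (fun _ => 1) γ i
  have hconst : (fun t => expSum b β (fun _ => 1) γ (Function.update a i t)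
      (φ (Function.update a i t))) =ᶠ[nhds (a i)] fun _ => -1 := by
    filter_upwards [eventually_update_mem hU ha i] with t ht
    have := hzero _ ht
    simp only [expSum, one_mul]
    linear_combination this
  have h' := h.unique ((hasDerivAt_const (a i) (-1 : ℂ)).congr_of_eventuallyEq hconst)
  rw [zeroSlope]
  linear_combination h'

theorem zeroSlope_ne_zero (hd : 1 ≤ d) (hU : IsOpen U) (hφ : ContDiffOn ℂ (⊤ : ℕ∞) φ U)
    (hslit : ∀ a ∈ U, φ a ∈ Complex.slitPlane)
    (hzero : ∀ a ∈ U, 1 + b * φ a ^ β + ∑ i, a i * φ a ^ γ i = 0) (ha : a ∈ U) :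
    zeroSlope b β γ φ a ≠ 0 := fun h0 => by
  have h := zeroSlope_mul_pderivC hU hφ hslit hzero ha ⟨0, hd⟩
  have hp := Complex.slitPlane_ne_zero (hslit a ha)
  simp [h0, Complex.cpow_eq_zero_iff, hp] at h

/-- The function `φ^(q-1) ∂₀φ`, where `∂₀` is the derivative with respect to the constant term
of `1 + b z^β + ∑ aⱼ z^(γⱼ)`. -/
noncomputable def powMulDerivConst {d : ℕ} (b β : ℂ) (γ : Fin d → ℂ) (φ : (Fin d → ℂ) → ℂ)
    (q : ℂ) (a : Fin d → ℂ) : ℂ :=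
  -φ a ^ (q - 1) / zeroSlope b β γ φ a

theorem pderivC_powMulDerivConst (hd : 1 ≤ d) (hU : IsOpen U) (hφ : ContDiffOn ℂ (⊤ : ℕ∞) φ U)
    (hslit : ∀ a ∈ U, φ a ∈ Complex.slitPlane)
    (hzero : ∀ a ∈ U, 1 + b * φ a ^ β + ∑ i, a i * φ a ^ γ i = 0) (ha : a ∈ U) (i : Fin d)
    (q : ℂ) :
    pderivC i (powMulDerivConst b β γ φ q) a =
      φ a ^ q * φ a ^ γ i / φ a ^ 2 * ((q + γ i - 1) / zeroSlope b β γ φ a ^ 2 -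
        φ a * expSum (b * β * (β - 1)) (β - 1 - 1) (fun j => 1 * γ j * (γ j - 1))
          (fun j => γ j - 1 - 1) a (φ a) / zeroSlope b β γ φ a ^ 3) := by
  have hD := zeroSlope_ne_zero hd hU hφ hslit hzero ha
  have hp := Complex.slitPlane_ne_zero (hslit a ha)
  have hφa := hφ.differentiableAt_of_mem_open hU ha
  have hφi : pderivC i φ a = -φ a ^ γ i / zeroSlope b β γ φ a := by
    rw [eq_div_iff hD, mul_comm]
    exact zeroSlope_mul_pderivC hU hφ hslit hzero ha i
  have hslope : HasDerivAt (fun t => zeroSlope b β γ φ (Function.update a i t)) _ (a i) :=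
    hasDerivAt_expSum_update hφa (hslit a ha) (b * β) (β - 1) (fun j => 1 * γ j)
      (fun j => γ j - 1) i
  have hpow : HasDerivAt (fun t => φ (Function.update a i t) ^ (q - 1))
      ((q - 1) * φ a ^ (q - 1 - 1) * pderivC i φ a) (a i) := by
    simpa [pderivC_eq_fderiv hφa i] using
      (hφa.hasDerivAt_comp_update i).cpow_const (c := q - 1) (by simpa using hslit a ha)
  refine (hpow.neg.div hslope (by simpa using hD)).deriv.trans ?_
  simp only [Function.update_eq_self, Pi.neg_apply, hφi]
  generalize zeroSlope b β γ φ a = D at hD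
  generalize expSum _ _ _ _ a (φ a) = D'
  simp only [Complex.cpow_sub _ _ hp, Complex.cpow_one]
  field_simp
  ring

theorem powMulDerivConst_euler_recursion (hd : 1 ≤ d) (hβ : β ≠ 0) (hU : IsOpen U)
    (hφ : ContDiffOn ℂ (⊤ : ℕ∞) φ U) (hslit : ∀ a ∈ U, φ a ∈ Complex.slitPlane)
    (hzero : ∀ a ∈ U, 1 + b * φ a ^ β + ∑ i, a i * φ a ^ γ i = 0) (ha : a ∈ U) (i : Fin d)
    (q : ℂ) :
    pderivC i (powMulDerivConst b β γ φ q) a =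
      ((q + γ i) / β - 1) * powMulDerivConst b β γ φ (q + γ i) a +
      ∑ j, (γ j / β - 1) * (a j * pderivC j (powMulDerivConst b β γ φ (q + γ i)) a) := by
  have hD := zeroSlope_ne_zero hd hU hφ hslit hzero ha
  have hp := Complex.slitPlane_ne_zero (hslit a ha)
  simp only [pderivC_powMulDerivConst hd hU hφ hslit hzero ha]
  have hS0 := hzero a ha
  set S0 := ∑ j, a j * φ a ^ γ j with hS0_def
  set S1 := ∑ j, a j * φ a ^ γ j * γ j with hS1_def
  set S2 := ∑ j, a j * φ a ^ γ j * γ j ^ 2 with hS2_def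
  have hS1 : φ a * zeroSlope b β γ φ a = b * φ a ^ β * β + S1 := by
    rw [zeroSlope, expSum, mul_add, Finset.mul_sum, hS1_def]
    simp only [Complex.cpow_sub _ _ hp, Complex.cpow_one]
    congr 1
    · field_simp
    · exact Finset.sum_congr rfl fun j _ => by field_simp
  have hS2 : φ a ^ 2 * expSum (b * β * (β - 1)) (β - 1 - 1) (fun j => 1 * γ j * (γ j - 1))
      (fun j => γ j - 1 - 1) a (φ a) = b * φ a ^ β * (β * (β - 1)) + (S2 - S1) := by
    rw [expSum, mul_add, Finset.mul_sum, hS1_def, hS2_def, ← Finset.sum_sub_distrib]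
    simp only [Complex.cpow_sub _ _ hp, Complex.cpow_one]
    congr 1
    · field_simp
    · exact Finset.sum_congr rfl fun j _ => by field_simp
  rw [powMulDerivConst]
  generalize zeroSlope b β γ φ a = D at *
  generalize expSum _ _ _ _ a (φ a) = D' at *
  have hsum : ∑ j, (γ j / β - 1) * (a j * (φ a ^ (q + γ i) * φ a ^ γ j / φ a ^ 2 *
      ((q + γ i + γ j - 1) / D ^ 2 - φ a * D' / D ^ 3))) =
      φ a ^ (q + γ i) / φ a ^ 2 * ((S2 / β - S1) / D ^ 2 +
        (S1 / β - S0) * ((q + γ i - 1) / D ^ 2 - φ a * D' / D ^ 3)) := by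
    simp only [hS0_def, hS1_def, hS2_def, Finset.sum_div, ← Finset.sum_sub_distrib,
      Finset.sum_mul, Finset.mul_sum, ← Finset.sum_add_distrib]
    exact Finset.sum_congr rfl fun j _ => by ring
  rw [hsum]
  have e1 : S1 = φ a * D + β * (1 + S0) := by linear_combination -hS1 - β * hS0
  have e2 : S2 = φ a ^ 2 * D' + S1 + β * (β - 1) * (1 + S0) := by
    linear_combination -hS2 - β * (β - 1) * hS0
  rw [e2, e1]
  simp only [Complex.cpow_sub _ _ hp, Complex.cpow_add _ _ hp, Complex.cpow_one]
  field_simp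
  ring

end ImplicitZero

theorem taylor_coefficient_two_term_base
    {d : ℕ} (hd : 1 ≤ d) (γ : Fin d → ℂ) (b β : ℂ) (hb : b ≠ 0) (hβ : β ≠ 0)
    (α : ℂ) (hα : α ∈ Complex.slitPlane) (hαzero : 1 + b * α ^ β = 0)
    (U : Set (Fin d → ℂ)) (hU : IsOpen U) (h0U : (0 : Fin d → ℂ) ∈ U)
    (φ : (Fin d → ℂ) → ℂ) (hφ : ContDiffOn ℂ (⊤ : ℕ∞) φ U)
    (hφ0 : φ 0 = α) (hφslit : ∀ a ∈ U, φ a ∈ Complex.slitPlane)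
    (hzero : ∀ a ∈ U, 1 + b * φ a ^ β + ∑ i, a i * φ a ^ γ i = 0)
    (n : Fin d → ℕ) (hn : 1 ≤ ∑ i, n i) :
    mixedPartial n φ 0 =
      -(α ^ ((1 : ℂ) + ∑ i, (n i : ℂ) * (γ i - 1)) / (b * β * α ^ (β - 1)) ^ (∑ i, n i)) *
        ∏ i ∈ Finset.Icc 1 ((∑ i, n i) - 1), (-1 + (i : ℂ) * β - ∑ j, (n j : ℂ) * γ j) := by
  have hp : α ≠ 0 := Complex.slitPlane_ne_zero hα
  have hslope : ∀ a ∈ U, zeroSlope b β γ φ a ≠ 0 := fun a ha =>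
    zeroSlope_ne_zero hd hU hφ hφslit hzero ha
  have hsmooth : ∀ q, ContDiffOn ℂ (⊤ : ℕ∞) (powMulDerivConst b β γ φ q) U := fun q =>
    (hφ.cpow_const hφslit _).neg.div (hφ.expSum hφslit _ _ _ _) hslope
  have hslope0 : zeroSlope b β γ φ 0 = -β / α := by
    simp only [zeroSlope, expSum, Pi.zero_apply, zero_mul, Finset.sum_const_zero, add_zero, hφ0,
      Complex.cpow_sub _ _ hp, Complex.cpow_one]
    field_simp
    linear_combination hαzero
  have hfirst : ∀ i, Set.EqOn (pderivC i φ) (powMulDerivConst b β γ φ (1 + γ i)) U := by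
    intro i a ha
    rw [powMulDerivConst, add_sub_cancel_left, eq_div_iff (hslope a ha), mul_comm]
    exact zeroSlope_mul_pderivC hU hφ hφslit hzero ha i
  have hbase : b * β * α ^ (β - 1) = -β / α := by
    rw [Complex.cpow_sub _ _ hp, Complex.cpow_one]
    field_simp
    linear_combination hαzero
  have hlength : ((List.finRange d).flatMap fun i => List.replicate (n i) i).length =
      ∑ i, n i := by
    simp [List.length_flatMap, ← List.ofFn_eq_map, List.sum_ofFn]
  have hsumγ := sum_map_flatMap_replicate n γ
  rw [mixedPartial_eq_iteratedPderivC]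
  generalize ((List.finRange d).flatMap fun i => List.replicate (n i) i) = L at hlength hsumγ
  obtain rfl | ⟨L, i, rfl⟩ := L.eq_nil_or_concat'
  · simp at hlength
    omega
  obtain ⟨N, hN⟩ : ∃ N, ∑ i, n i = N + 1 := ⟨_, (Nat.sub_add_cancel hn).symm⟩
  have hlen : L.length = N := by simpa [hN] using hlength
  have hexp : 1 + ∑ i, (n i : ℂ) * (γ i - 1) = 1 + ∑ i, (n i : ℂ) * γ i - (N + 1 : ℕ) := by
    rw [← hN]
    push_cast
    simp only [mul_sub, mul_one, Finset.sum_sub_distrib]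
    ring
  have hS : 1 + γ i + (L.map γ).sum = 1 + ∑ j, (n j : ℂ) * γ j := by
    rw [← hsumγ]
    simp
    ring
  rw [iteratedPderivC_concat, iteratedPderivC_congr hU (hfirst i) L h0U,
    iteratedPderivC_zero_of_euler_recursion hU h0U γ β _ hsmooth
      (fun i q a ha => powMulDerivConst_euler_recursion hd hβ hU hφ hφslit hzero ha i q),
    hS, hlen, hexp, hN, hbase, powMulDerivConst, hslope0, hφ0, Nat.add_sub_cancel,
    Complex.cpow_sub _ _ hp, Complex.cpow_sub _ _ hp, Complex.cpow_natCast, Complex.cpow_one]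
  generalize ∑ j, (n j : ℂ) * γ j = S
  have hprod : ∏ k ∈ Finset.Icc 1 N, (-1 + (k : ℂ) * β - S) =
      (-β) ^ N * ∏ k ∈ Finset.Icc 1 N, ((1 + S) / β - (k : ℂ)) := by
    have hcard : (-β) ^ N = ∏ _k ∈ Finset.Icc 1 N, (-β) := by simp
    rw [hcard, ← Finset.prod_mul_distrib]
    refine Finset.prod_congr rfl fun k _ => ?_
    field_simp
    ring
  rw [hprod, div_pow, pow_succ (-β)]
  have hβN : (-β) ^ N ≠ 0 := pow_ne_zero _ (neg_ne_zero.2 hβ)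
  generalize (-β) ^ N = B at hβN
  field_simp
end

section
/- For all integers 1 ≤ k ≤ N and all complex numbers ν, x₁,…,x_N: (1/(k−1)!)·Σ_{r=0}^{k−1} (−1)^{k−1−r}·binom(k−1,r)·((r+1)ν − 1 + Σ_{i=1}^N x_i)_{N−1} = ν^{k−1}·Σ_{P ∈ S(N,k)} ∏_{B ∈ P} (ν − 1 + Σ_{m∈B} x_m)_{|B|−1}. -/
open Finset Complex

noncomputable def fallFac (z : ℂ) (k : ℕ) : ℂ := ∏ j ∈ Finset.range k, (z - j)

/-- Unordered partitions of the finite set `H` into `k` non-empty pairwise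
disjoint blocks. -/
def setPartitions {β : Type*} [DecidableEq β] (H : Finset β) (k : ℕ) :
    Finset (Finset (Finset β)) :=
  H.powerset.powerset.filter fun P =>
    P.card = k ∧ (∀ B ∈ P, B.Nonempty) ∧
      (∀ B ∈ P, ∀ B' ∈ P, B ≠ B' → Disjoint B B') ∧ P.sup id = H

theorem fallFac_zero (z : ℂ) : fallFac z 0 = 1 := by simp [fallFac]

theorem fallFac_succ (z : ℂ) (k : ℕ) : fallFac z (k + 1) = fallFac z k * (z - k) := by
  simp [fallFac, Finset.prod_range_succ]

theorem fallFac_succ' (z : ℂ) (k : ℕ) : fallFac z (k + 1) = z * fallFac (z - 1) k := by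
  simp only [fallFac, Finset.prod_range_succ', Nat.cast_zero, sub_zero, Nat.cast_succ]
  rw [mul_comm]
  congr 1
  exact Finset.prod_congr rfl fun j _ => by ring

theorem fallFac_add (z : ℂ) (m n : ℕ) :
    fallFac z (m + n) = fallFac z m * fallFac (z - m) n := by
  simp only [fallFac, Finset.prod_range_add]
  congr 1
  exact Finset.prod_congr rfl fun j _ => by push_cast; ring

theorem fallFac_neg (z : ℂ) (n : ℕ) :
    fallFac (-z) n = (-1) ^ n * fallFac (z + n - 1) n := by
  induction n generalizing z with
  | zero => simp [fallFac_zero]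
  | succ n ih =>
    rw [fallFac_succ', show -z - 1 = -(z + 1) by ring, ih, fallFac_succ,
      show z + 1 + (n : ℂ) - 1 = z + ((n + 1 : ℕ) : ℂ) - 1 by push_cast; ring]
    push_cast
    ring

theorem fallFac_natCast (r j : ℕ) : fallFac r j = (j.factorial : ℂ) * (r.choose j : ℂ) := by
  rw [← Nat.cast_mul, ← Nat.descFactorial_eq_factorial_mul_choose]
  induction j with
  | zero => simp [fallFac_zero]
  | succ j ih =>
    rw [fallFac_succ, ih, Nat.descFactorial_succ]
    rcases le_or_gt j r with h | h
    · push_cast [Nat.cast_sub h]; ring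
    · simp [Nat.descFactorial_of_lt h]

/-- The Chu–Vandermonde identity, summed over subsets instead of over their sizes. -/
theorem fallFac_add_card {β : Type*} [DecidableEq β] (p q : ℂ) (A : Finset β) :
    fallFac (p + q) A.card =
      ∑ I ∈ A.powerset, fallFac p I.card * fallFac q (A \ I).card := by
  induction A using Finset.induction_on with
  | empty => simp [fallFac_zero]
  | insert a A ha ih =>
    rw [Finset.sum_powerset_insert ha, Finset.card_insert_of_notMem ha, fallFac_succ, ih,
      Finset.sum_mul, ← Finset.sum_add_distrib]
    refine Finset.sum_congr rfl fun I hI => ?_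
    rw [Finset.mem_powerset] at hI
    have haI : a ∉ I := fun h => ha (hI h)
    rw [Finset.insert_sdiff_of_notMem _ haI, Finset.card_insert_of_notMem (by simp [ha]),
      Finset.card_insert_of_notMem haI, Finset.insert_sdiff_insert,
      Finset.sdiff_insert_of_notMem ha, fallFac_succ, fallFac_succ,
      ← Finset.card_sdiff_add_card_eq_card hI]
    push_cast
    ring

theorem sum_powerset_neg_one_pow_mul_fallFac {β : Type*} [DecidableEq β] (y : β → ℂ)
    (M : Finset β) (m : ℕ) (hm : m < M.card) (c : ℂ) :
    ∑ D ∈ M.powerset, (-1 : ℂ) ^ D.card * fallFac (c + ∑ i ∈ D, y i) m = 0 := by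
  induction M using Finset.induction_on generalizing m with
  | empty => simp at hm
  | insert b M hb ih =>
    rw [Finset.card_insert_of_notMem hb] at hm
    rw [Finset.sum_powerset_insert hb, ← Finset.sum_add_distrib]
    have hterm : ∀ D ∈ M.powerset,
        (-1 : ℂ) ^ D.card * fallFac (c + ∑ i ∈ D, y i) m +
            (-1 : ℂ) ^ (insert b D).card * fallFac (c + ∑ i ∈ insert b D, y i) m =
          -∑ I ∈ (Finset.range m).powerset.erase ∅, fallFac (y b) I.card *
            ((-1 : ℂ) ^ D.card * fallFac (c + ∑ i ∈ D, y i) (Finset.range m \ I).card) := by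
      intro D hD
      have hbD : b ∉ D := fun h => hb (Finset.mem_powerset.1 hD h)
      have hV := fallFac_add_card (y b) (c + ∑ i ∈ D, y i) (Finset.range m)
      rw [← Finset.add_sum_erase _ _ (Finset.empty_mem_powerset _)] at hV
      simp only [Finset.card_range, Finset.card_empty, fallFac_zero, Finset.sdiff_empty,
        one_mul] at hV
      rw [Finset.card_insert_of_notMem hbD, Finset.sum_insert hbD,
        show c + (y b + ∑ i ∈ D, y i) = y b + (c + ∑ i ∈ D, y i) by ring, hV]
      have hfac : ∀ I : Finset ℕ, fallFac (y b) I.card *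
            ((-1 : ℂ) ^ D.card * fallFac (c + ∑ i ∈ D, y i) (Finset.range m \ I).card) =
          (-1 : ℂ) ^ D.card *
            (fallFac (y b) I.card * fallFac (c + ∑ i ∈ D, y i) (Finset.range m \ I).card) :=
        fun I => by ring
      simp only [hfac, ← Finset.mul_sum]
      ring
    rw [Finset.sum_congr rfl hterm, Finset.sum_neg_distrib, Finset.sum_comm, neg_eq_zero]
    refine Finset.sum_eq_zero fun I hI => ?_
    rw [Finset.mem_erase, Finset.mem_powerset] at hI
    have hpos := Finset.card_pos.2 (Finset.nonempty_iff_ne_empty.2 hI.1)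
    have hcard := Finset.card_sdiff_add_card_eq_card hI.2
    rw [Finset.card_range] at hcard
    rw [← Finset.mul_sum, ih _ (by omega), mul_zero]

/-- The falling-factorial analogue of the Abel–Hurwitz factor `z * (z + ∑ i ∈ D, x i) ^ (|D| - 1)`. -/
noncomputable def hurwitzFactor {β : Type*} [DecidableEq β] (x : β → ℂ) (D : Finset β)
    (z : ℂ) : ℂ :=
  if D = ∅ then 1 else z * fallFac (z - 1 + ∑ i ∈ D, x i) (D.card - 1)

theorem sum_powerset_fallFac_neg_mul_hurwitzFactor {β : Type*} [DecidableEq β] (x : β → ℂ)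
    (M : Finset β) (hM : M.Nonempty) (z : ℂ) :
    ∑ D ∈ M.powerset, fallFac (-(z + ∑ i ∈ D, x i)) (M \ D).card * hurwitzFactor x D z = 0 := by
  have hpos := Finset.card_pos.2 hM
  have hterm : ∀ D ∈ M.powerset,
      fallFac (-(z + ∑ i ∈ D, x i)) (M \ D).card * hurwitzFactor x D z =
        ((-1) ^ M.card * z) * ((-1 : ℂ) ^ D.card *
          fallFac (z + M.card - 1 + ∑ i ∈ D, (x i - 1)) (M.card - 1)) := by
    intro D hD
    rw [Finset.mem_powerset] at hD
    have hcard := Finset.card_sdiff_add_card_eq_card hD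
    have hsum : ∑ i ∈ D, (x i - 1) = ∑ i ∈ D, x i - D.card := by
      simp [Finset.sum_sub_distrib]
    have hsign : (-1 : ℂ) ^ M.card * (-1) ^ D.card = (-1) ^ (M \ D).card := by
      rw [← hcard, pow_add, mul_assoc, ← pow_add, ← two_mul, pow_mul]
      simp
    rw [fallFac_neg, ← hsign, hsum, hurwitzFactor]
    split_ifs with h
    · subst h
      obtain ⟨n, hn⟩ : ∃ n, M.card = n + 1 := ⟨M.card - 1, by omega⟩
      simp only [Finset.sdiff_empty, Finset.sum_empty, Finset.card_empty, hn, fallFac_succ,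
        Nat.add_sub_cancel]
      push_cast
      simp only [sub_zero, add_zero]
      ring
    · have hDpos := Finset.card_pos.2 (Finset.nonempty_iff_ne_empty.2 h)
      rw [show M.card - 1 = (M \ D).card + (D.card - 1) by omega, fallFac_add]
      have hc : (M.card : ℂ) = (M \ D).card + D.card := by exact_mod_cast hcard.symm
      rw [show z + (M.card : ℂ) - 1 + (∑ i ∈ D, x i - D.card) =
          z + ∑ i ∈ D, x i + ((M \ D).card : ℂ) - 1 by rw [hc]; ring,
        show z + ∑ i ∈ D, x i + ((M \ D).card : ℂ) - 1 - ((M \ D).card : ℂ) =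
          z - 1 + ∑ i ∈ D, x i by ring]
      ring
  rw [Finset.sum_congr rfl hterm, ← Finset.mul_sum,
    sum_powerset_neg_one_pow_mul_fallFac _ _ _ (by omega), mul_zero]

/-- Hurwitz's identity for falling factorials. -/
theorem sum_powerset_fallFac_mul_hurwitzFactor {β : Type*} [DecidableEq β] (x : β → ℂ)
    (K : Finset β) (w z : ℂ) :
    ∑ A ∈ K.powerset, fallFac (w + ∑ i ∈ A, x i) A.card * hurwitzFactor x (K \ A) z =
      fallFac (w + z + ∑ i ∈ K, x i) K.card := by
  set p := w + z + ∑ i ∈ K, x i with hp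
  have hexp : ∀ A ∈ K.powerset,
      fallFac (w + ∑ i ∈ A, x i) A.card * hurwitzFactor x (K \ A) z =
        ∑ I ∈ A.powerset, fallFac p I.card *
          (fallFac (-(z + ∑ i ∈ K \ A, x i)) (A \ I).card * hurwitzFactor x (K \ A) z) := by
    intro A hA
    have hs := Finset.sum_sdiff (f := x) (Finset.mem_powerset.1 hA)
    rw [show w + ∑ i ∈ A, x i = p + -(z + ∑ i ∈ K \ A, x i) by rw [hp, ← hs]; ring,
      fallFac_add_card, Finset.sum_mul]
    exact Finset.sum_congr rfl fun I _ => by ring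
  rw [Finset.sum_congr rfl hexp, Finset.sum_comm' (t' := K.powerset)
    (s' := fun I => K.powerset.filter (I ⊆ ·))]
  swap
  · intro A I
    simp only [Finset.mem_powerset, Finset.mem_filter]
    exact ⟨fun h => ⟨⟨h.1, h.2⟩, h.2.trans h.1⟩, fun h => h.1⟩
  have hinner : ∀ I ∈ K.powerset,
      ∑ A ∈ K.powerset.filter (I ⊆ ·), fallFac p I.card *
          (fallFac (-(z + ∑ i ∈ K \ A, x i)) (A \ I).card * hurwitzFactor x (K \ A) z) =
        fallFac p I.card * ∑ D ∈ (K \ I).powerset,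
          fallFac (-(z + ∑ i ∈ D, x i)) ((K \ I) \ D).card * hurwitzFactor x D z := by
    intro I hI
    rw [Finset.mem_powerset] at hI
    rw [← Finset.mul_sum]
    congr 1
    refine Finset.sum_nbij' (K \ ·) (K \ ·) ?_ ?_ ?_ ?_ ?_
    · intro A hA
      simp only [Finset.mem_filter, Finset.mem_powerset] at hA ⊢
      exact Finset.sdiff_subset_sdiff le_rfl hA.2
    · intro D hD
      simp only [Finset.mem_filter, Finset.mem_powerset] at hD ⊢
      exact ⟨Finset.sdiff_subset, fun i hi => Finset.mem_sdiff.2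
        ⟨hI hi, fun h => (Finset.mem_sdiff.1 (hD h)).2 hi⟩⟩
    · intro A hA
      simp only [Finset.mem_filter, Finset.mem_powerset] at hA
      exact Finset.sdiff_sdiff_eq_self hA.1
    · intro D hD
      simp only [Finset.mem_powerset] at hD
      exact Finset.sdiff_sdiff_eq_self (hD.trans Finset.sdiff_subset)
    · intro A hA
      simp only [Finset.mem_filter, Finset.mem_powerset] at hA
      rw [show (K \ I) \ (K \ A) = A \ I by
        ext i; have := @hA.1 i; simp only [Finset.mem_sdiff]; tauto]
  rw [Finset.sum_congr rfl hinner, Finset.sum_eq_single K]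
  · simp [fallFac_zero, hurwitzFactor]
  · intro I hI hne
    rw [sum_powerset_fallFac_neg_mul_hurwitzFactor, mul_zero]
    rw [Finset.sdiff_nonempty]
    exact fun h => hne (Finset.Subset.antisymm (Finset.mem_powerset.1 hI) h)
  · simp

theorem mem_setPartitions {β : Type*} [DecidableEq β] {H : Finset β} {k : ℕ}
    {P : Finset (Finset β)} :
    P ∈ setPartitions H k ↔ P.card = k ∧ (∀ B ∈ P, B.Nonempty) ∧
      (∀ B ∈ P, ∀ B' ∈ P, B ≠ B' → Disjoint B B') ∧ P.sup id = H := by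
  simp only [setPartitions, Finset.mem_filter, Finset.mem_powerset, and_iff_right_iff_imp]
  rintro ⟨-, -, -, rfl⟩ B hB
  exact Finset.mem_powerset.2 (Finset.le_sup (f := id) hB)

theorem setPartitions_zero_of_nonempty {β : Type*} [DecidableEq β] {H : Finset β}
    (hH : H.Nonempty) : setPartitions H 0 = ∅ := by
  refine Finset.eq_empty_of_forall_notMem fun P hP => hH.ne_empty ?_
  obtain ⟨hc, -, -, rfl⟩ := mem_setPartitions.1 hP
  simp [Finset.card_eq_zero.1 hc]

theorem setPartitions_empty_zero {β : Type*} [DecidableEq β] :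
    setPartitions (∅ : Finset β) 0 = {∅} := by
  ext P
  rw [mem_setPartitions, Finset.mem_singleton, Finset.card_eq_zero]
  exact ⟨fun h => h.1, by rintro rfl; simp⟩

theorem setPartitions_empty_succ {β : Type*} [DecidableEq β] (k : ℕ) :
    setPartitions (∅ : Finset β) (k + 1) = ∅ := by
  refine Finset.eq_empty_of_forall_notMem fun P hP => ?_
  obtain ⟨hc, hne, -, hsup⟩ := mem_setPartitions.1 hP
  obtain ⟨B, hB⟩ := Finset.card_pos.1 (by omega : 0 < P.card)
  have hle := Finset.le_sup (f := id) hB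
  rw [hsup] at hle
  exact (hne B hB).ne_empty (Finset.subset_empty.1 hle)

/-- A partition of `insert a K` is a block `insert a A` together with a partition of `K \ A`. -/
theorem sum_setPartitions_insert {β : Type*} [DecidableEq β] (g : Finset β → ℂ)
    {a : β} {K : Finset β} (ha : a ∉ K) (j : ℕ) :
    ∑ P ∈ setPartitions (insert a K) (j + 1), ∏ B ∈ P, g B =
      ∑ A ∈ K.powerset, g (insert a A) *
        ∑ P ∈ setPartitions (K \ A) j, ∏ B ∈ P, g B := by
  simp only [Finset.mul_sum]
  rw [Finset.sum_sigma']
  have hsub : ∀ {A : Finset β} {Q : Finset (Finset β)}, Q ∈ setPartitions (K \ A) j →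
      ∀ B ∈ Q, B ⊆ K \ A := fun hQ B hB => by
    rw [← (mem_setPartitions.1 hQ).2.2.2]
    exact Finset.le_sup (f := id) hB
  have hnot : ∀ {A : Finset β} {Q : Finset (Finset β)}, Q ∈ setPartitions (K \ A) j →
      ∀ B ∈ Q, a ∉ B := fun hQ B hB h => ha (Finset.mem_sdiff.1 (hsub hQ B hB h)).1
  symm
  refine Finset.sum_bij (fun s _ => insert (insert a s.1) s.2) ?_ ?_ ?_ ?_
  · rintro ⟨A, Q⟩ hs
    obtain ⟨hA, hQ⟩ := Finset.mem_sigma.1 hs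
    rw [Finset.mem_powerset] at hA
    obtain ⟨hc, hne, hdisj, hsup⟩ := mem_setPartitions.1 hQ
    have hd : ∀ B ∈ Q, Disjoint (insert a A) B := fun B hB => by
      rw [Finset.disjoint_insert_left]
      exact ⟨hnot hQ B hB, Finset.disjoint_sdiff.mono_right (hsub hQ B hB)⟩
    refine mem_setPartitions.2 ⟨?_, ?_, ?_, ?_⟩
    · rw [Finset.card_insert_of_notMem
        fun h => hnot hQ _ h (Finset.mem_insert_self a A), hc]
    · intro B hB
      rcases Finset.mem_insert.1 hB with rfl | hB
      · exact Finset.insert_nonempty a A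
      · exact hne B hB
    · intro B hB B' hB' hBB'
      rcases Finset.mem_insert.1 hB with rfl | hB <;>
        rcases Finset.mem_insert.1 hB' with rfl | hB'
      · exact absurd rfl hBB'
      · exact hd B' hB'
      · exact (hd B hB).symm
      · exact hdisj B hB B' hB' hBB'
    · rw [Finset.sup_insert, hsup, id, Finset.sup_eq_union, Finset.insert_union,
        Finset.union_sdiff_of_subset hA]
  · rintro ⟨A, Q⟩ hs ⟨A', Q'⟩ hs' heq
    obtain ⟨hA, hQ⟩ := Finset.mem_sigma.1 hs
    obtain ⟨hA', hQ'⟩ := Finset.mem_sigma.1 hs'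
    rw [Finset.mem_powerset] at hA hA'
    dsimp only at heq hA hA' hQ hQ'
    have hblock : insert a A = insert a A' := by
      have hmem := heq ▸ Finset.mem_insert_self (insert a A) Q
      rcases Finset.mem_insert.1 hmem with h | h
      · exact h
      · exact absurd (Finset.mem_insert_self a A) (hnot hQ' _ h)
    have hAA' : A = A' := by
      rw [← Finset.erase_insert fun h => ha (hA h), hblock,
        Finset.erase_insert fun h => ha (hA' h)]
    subst hAA'
    have hQQ' : Q = Q' := by
      rw [← Finset.erase_insert fun h => hnot hQ _ h (Finset.mem_insert_self a A), heq,
        Finset.erase_insert fun h => hnot hQ' _ h (Finset.mem_insert_self a A)]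
    rw [hQQ']
  · intro P hP
    obtain ⟨hc, hne, hdisj, hsup⟩ := mem_setPartitions.1 hP
    obtain ⟨B, hB, haB⟩ : ∃ B ∈ P, a ∈ B := by
      have := Finset.mem_insert_self a K
      rw [← hsup, Finset.mem_sup] at this
      exact this
    have hBsub : B ⊆ insert a K := by
      rw [← hsup]; exact Finset.le_sup (f := id) hB
    refine ⟨⟨B.erase a, P.erase B⟩, Finset.mem_sigma.2 ⟨?_, mem_setPartitions.2
      ⟨?_, ?_, ?_, ?_⟩⟩, ?_⟩
    · exact Finset.mem_powerset.2 (Finset.subset_insert_iff.1 hBsub)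
    · rw [Finset.card_erase_of_mem hB, hc, Nat.add_sub_cancel]
    · exact fun C hC => hne C (Finset.mem_of_mem_erase hC)
    · exact fun C hC C' hC' => hdisj C (Finset.mem_of_mem_erase hC) C' (Finset.mem_of_mem_erase hC')
    · ext i
      have hi : i ∈ P.sup id ↔ i ∈ insert a K := by rw [hsup]
      rw [Finset.mem_sup, Finset.mem_insert] at hi
      simp only [Finset.mem_sup, Finset.mem_sdiff, Finset.mem_erase, id] at hi ⊢
      constructor
      · rintro ⟨C, ⟨hCB, hC⟩, hiC⟩
        have hiB : i ∉ B := Finset.disjoint_left.1 (hdisj C hC B hB hCB) hiC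
        have hia : i ≠ a := fun h => hiB (h ▸ haB)
        exact ⟨(hi.1 ⟨C, hC, hiC⟩).resolve_left hia, fun h => hiB h.2⟩
      · rintro ⟨hiK, hiB⟩
        obtain ⟨C, hC, hiC⟩ := hi.2 (Or.inr hiK)
        refine ⟨C, ⟨?_, hC⟩, hiC⟩
        rintro rfl
        exact hiB ⟨fun h => ha (h ▸ hiK), hiC⟩
    · dsimp only
      rw [Finset.insert_erase haB, Finset.insert_erase hB]
  · rintro ⟨A, Q⟩ hs
    obtain ⟨-, hQ⟩ := Finset.mem_sigma.1 hs
    rw [Finset.prod_insert fun h => hnot hQ _ h (Finset.mem_insert_self a A)]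

/-- The expansion of `hurwitzFactor` at `t * ν` yields the one of the corresponding
falling factorial of `insert a K` at `(t + 1) * ν`. -/
theorem fallFac_insert_eq_sum_setPartitions {β : Type*} [DecidableEq β] (x : β → ℂ) (ν t : ℂ)
    {a : β} {K : Finset β} (ha : a ∉ K) (n : ℕ)
    (h : ∀ D ⊆ K, hurwitzFactor x D (t * ν) =
      ∑ j ∈ Finset.range (n + 1), fallFac t j * ν ^ j * ∑ P ∈ setPartitions D j,
        ∏ B ∈ P, fallFac (ν - 1 + ∑ m ∈ B, x m) (B.card - 1)) :
    fallFac ((t + 1) * ν - 1 + ∑ i ∈ insert a K, x i) K.card =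
      ∑ j ∈ Finset.range (n + 1), fallFac t j * ν ^ j *
        ∑ P ∈ setPartitions (insert a K) (j + 1),
          ∏ B ∈ P, fallFac (ν - 1 + ∑ m ∈ B, x m) (B.card - 1) := by
  have hH := sum_powerset_fallFac_mul_hurwitzFactor x K (ν - 1 + x a) (t * ν)
  rw [Finset.sum_insert ha, show (t + 1) * ν - 1 + (x a + ∑ i ∈ K, x i) =
    ν - 1 + x a + t * ν + ∑ i ∈ K, x i by ring, ← hH]
  simp only [sum_setPartitions_insert _ ha, Finset.mul_sum (K.powerset)]
  rw [Finset.sum_comm]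
  refine Finset.sum_congr rfl fun A hA => ?_
  have haA : a ∉ A := fun h => ha (Finset.mem_powerset.1 hA h)
  rw [h _ Finset.sdiff_subset, Finset.mul_sum, Finset.sum_insert haA,
    Finset.card_insert_of_notMem haA, Nat.add_sub_cancel]
  exact Finset.sum_congr rfl fun j _ => by rw [← add_assoc]; ring

theorem hurwitzFactor_eq_sum_setPartitions {β : Type*} [DecidableEq β] (x : β → ℂ) (ν t : ℂ)
    (n : ℕ) (D : Finset β) (hD : D.card ≤ n) :
    hurwitzFactor x D (t * ν) =
      ∑ j ∈ Finset.range (n + 1), fallFac t j * ν ^ j * ∑ P ∈ setPartitions D j,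
        ∏ B ∈ P, fallFac (ν - 1 + ∑ m ∈ B, x m) (B.card - 1) := by
  induction n generalizing t D with
  | zero =>
    obtain rfl : D = ∅ := by simpa using hD
    simp [hurwitzFactor, setPartitions_empty_zero, fallFac_zero]
  | succ n ih =>
    rw [Finset.sum_range_succ']
    rcases D.eq_empty_or_nonempty with rfl | hne
    · simp [hurwitzFactor, setPartitions_empty_zero, setPartitions_empty_succ, fallFac_zero]
    · obtain ⟨a, haD⟩ := id hne
      obtain ⟨K, ha, rfl⟩ : ∃ K, a ∉ K ∧ insert a K = D :=
        ⟨D.erase a, Finset.notMem_erase a D, Finset.insert_erase haD⟩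
      rw [Finset.card_insert_of_notMem ha] at hD
      have hK := fallFac_insert_eq_sum_setPartitions x ν (t - 1) ha n fun E hE =>
        ih (t - 1) E ((Finset.card_le_card hE).trans (by omega))
      rw [sub_add_cancel] at hK
      rw [hurwitzFactor, if_neg hne.ne_empty, Finset.card_insert_of_notMem ha,
        Nat.add_sub_cancel, hK, setPartitions_zero_of_nonempty hne, Finset.mul_sum]
      simp only [Finset.sum_empty, mul_zero, add_zero]
      exact Finset.sum_congr rfl fun j _ => by rw [fallFac_succ', pow_succ]; ring

theorem sum_neg_one_pow_mul_choose_mul_fallFac (n j : ℕ) :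
    ∑ r ∈ Finset.range (n + 1), (-1 : ℂ) ^ (n - r) * (n.choose r : ℂ) * fallFac r j =
      if n = j then (n.factorial : ℂ) else 0 := by
  have h := fwdDiff_iter_choose_zero j n
  rw [fwdDiff_iter_eq_sum_shift] at h
  have h' := congrArg (fun m : ℤ => (j.factorial : ℂ) * (m : ℂ)) h
  simp only [zero_add, smul_eq_mul, mul_one] at h'
  push_cast at h'
  rw [Finset.mul_sum] at h'
  refine Eq.trans (Finset.sum_congr rfl fun r _ => ?_) (h'.trans ?_)
  · rw [fallFac_natCast]; ring
  · split_ifs with hnj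
    · simp [hnj]
    · simp

theorem falling_factorial_partition_identity
    (N k : ℕ) (hk : 1 ≤ k) (hkN : k ≤ N) (ν : ℂ) (x : ℕ → ℂ) :
    (1 / ((Nat.factorial (k - 1)) : ℂ)) *
        ∑ r ∈ Finset.range k,
          (-1 : ℂ) ^ (k - 1 - r) * ((k - 1).choose r : ℂ) *
            fallFac (((r : ℂ) + 1) * ν - 1 + ∑ i ∈ Finset.Icc 1 N, x i) (N - 1) =
      ν ^ (k - 1) *
        ∑ P ∈ setPartitions (Finset.Icc 1 N) k,
          ∏ B ∈ P, fallFac (ν - 1 + ∑ m ∈ B, x m) (B.card - 1) := by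
  obtain ⟨n, rfl⟩ : ∃ n, k = n + 1 := ⟨k - 1, by omega⟩
  obtain ⟨M, rfl⟩ : ∃ M, N = M + 1 := ⟨N - 1, by omega⟩
  have hins : insert (M + 1) (Finset.Icc 1 M) = Finset.Icc 1 (M + 1) := by
    ext i; simp only [Finset.mem_insert, Finset.mem_Icc]; omega
  have hcard : (Finset.Icc 1 M).card = M := by simp
  have hexp : ∀ r : ℕ, _ := fun r => fallFac_insert_eq_sum_setPartitions x ν (r : ℂ)
    (a := M + 1) (K := Finset.Icc 1 M) (by simp) M fun D hD =>
      hurwitzFactor_eq_sum_setPartitions x ν r M D ((Finset.card_le_card hD).trans hcard.le)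
  rw [hins, hcard] at hexp
  simp only [Nat.add_sub_cancel, hexp, Finset.mul_sum (Finset.range (M + 1))]
  rw [Finset.sum_comm]
  simp only [← mul_assoc, ← Finset.sum_mul, sum_neg_one_pow_mul_choose_mul_fallFac]
  have hfac : (n.factorial : ℂ) ≠ 0 := by exact_mod_cast n.factorial_ne_zero
  rw [Finset.sum_eq_single n]
  · rw [if_pos rfl]; field_simp
  · intro j _ hj
    simp [Ne.symm hj]
  · intro h
    exact absurd (Finset.mem_range.2 (by omega)) h
end
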